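/- arXiv:math-ph/0611057 — 2 statements merged into one kernel-verified Lean document; each statement's English description precedes it below -/
import Mathlib

section
/- Let K₁, K₂ ∈ M_d and let T : M_d → M_d be the linear map T(A) = K₁ A K₁† + K₂ A K₂†. Then det T is real and det T ≥ 0, where det T is the determinant of T as a linear map on the d²-dimensional complex vector space M_d. -/
open Matrix
open scoped Kronecker ComplexOrder

noncomputable section

/-- `Mat d` is the space `M_d` of `d × d` complex matrices. -/
abbrev Mat (d : ℕ) := Matrix (Fin d) (Fin d) ℂ

open Polynomial Filter Topology ComplexConjugate

section

variable {n : Type*} [Fintype n] [DecidableEq n]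

theorem Multiset.reverse_prod_X_sub_C {R : Type*} [CommRing R] [IsDomain R] (s : Multiset R) :
    (s.map fun a => (X - C a : R[X])).prod.reverse = (s.map fun a => (1 - C a * X : R[X])).prod := by
  induction s using Multiset.induction with
  | empty => simpa using Polynomial.reverse_C (1 : R)
  | cons a s ih =>
    have h : (X - C a : R[X]).reverse = 1 - C a * X := by
      rw [Polynomial.reverse, natDegree_X_sub_C, reflect_sub, reflect_one_X, reflect_C, pow_one]
    simp [reverse_mul_of_domain, ih, h]

theorem Matrix.charpolyRev_eq_prod_roots {K : Type*} [Field K] [IsAlgClosed K] (M : Matrix n n K) :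
    M.charpolyRev = (M.charpoly.roots.map fun a => (1 - C a * X : K[X])).prod := by
  rw [← Matrix.reverse_charpoly, ← Multiset.reverse_prod_X_sub_C,
    ← (IsAlgClosed.splits M.charpoly).eq_prod_roots_of_monic M.charpoly_monic]

theorem Matrix.det_one_sub_kronecker {R : Type*} [CommRing R] (M N : Matrix n n R) :
    (1 - M ⊗ₖ N).det = (aeval N M.charpolyRev).det := by
  have h := Matrix.det_det (1 - (X : R[X]) • M.map C) (aeval N : R[X] →ₐ[R] Matrix n n R).toRingHom
  rw [AlgHom.toRingHom_eq_coe, RingHom.coe_coe] at h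
  rw [charpolyRev, h]
  congr 1
  ext ⟨i, k⟩ ⟨j, l⟩
  by_cases hij : i = j <;> by_cases hkl : k = l <;>
    simp [hij, hkl, Matrix.comp_apply, Matrix.sub_apply, Algebra.algebraMap_eq_smul_one]

theorem Matrix.det_one_add_smul_eq_prod_roots (M : Matrix n n ℂ) (c : ℂ) :
    (1 + c • M).det = (M.charpoly.roots.map fun a => 1 + c * a).prod := by
  have h : (1 + c • M).det = M.charpolyRev.eval (-c) := by
    rw [charpolyRev, ← coe_evalRingHom, RingHom.map_det]
    congr 1
    ext i j
    by_cases hij : i = j <;> simp [hij, mul_comm c]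
  rw [h, Matrix.charpolyRev_eq_prod_roots, eval_multiset_prod, Multiset.map_map]
  congr 1
  refine Multiset.map_congr rfl fun a _ => ?_
  simp
  ring

theorem Multiset.prod_one_add_mul_conj_nonneg (s : Multiset ℂ) :
    0 ≤ (s.map fun a => (s.map fun b => 1 + a * conj b).prod).prod := by
  induction s using Multiset.induction with
  | empty => simp
  | cons a s ih =>
    simp only [Multiset.map_cons, Multiset.prod_cons, Multiset.prod_map_mul]
    have h : (s.map fun i => 1 + i * conj a).prod = conj (s.map fun b => 1 + a * conj b).prod := by
      rw [map_multiset_prod, Multiset.map_map]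
      simp [mul_comm]
    rw [h, ← mul_assoc, mul_assoc (1 + a * conj a), Complex.mul_conj, Complex.mul_conj]
    refine mul_nonneg (mul_nonneg (add_nonneg zero_le_one ?_) ?_) ih <;>
      exact_mod_cast Complex.normSq_nonneg _

theorem Matrix.det_one_add_kronecker_conj_nonneg (M : Matrix n n ℂ) :
    0 ≤ (1 + M ⊗ₖ M.map conj).det := by
  have h : 1 + M ⊗ₖ M.map conj = 1 - M ⊗ₖ (-M.map conj) := by
    ext ⟨i, k⟩ ⟨j, l⟩
    simp
  have hf (a : ℂ) : (aeval (-M.map conj) (1 - C a * X : ℂ[X])).det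
      = (M.charpoly.roots.map fun b => 1 + a * conj b).prod := by
    have h1 : aeval (-M.map conj) (1 - C a * X : ℂ[X])
        = (starRingEnd ℂ).mapMatrix (1 + conj a • M) := by
      ext i j
      by_cases hij : i = j <;> simp [hij, Algebra.algebraMap_eq_smul_one]
    rw [h1, ← RingHom.map_det, Matrix.det_one_add_smul_eq_prod_roots, map_multiset_prod,
      Multiset.map_map]
    simp
  have hprod (s : Multiset ℂ) :
      (aeval (-M.map conj) (s.map fun a => (1 - C a * X : ℂ[X])).prod).det
        = (s.map fun a => (aeval (-M.map conj) (1 - C a * X : ℂ[X])).det).prod := by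
    induction s using Multiset.induction with
    | empty => simp
    | cons a s ih => simp only [Multiset.map_cons, Multiset.prod_cons, map_mul, det_mul, ih]
  rw [h, Matrix.det_one_sub_kronecker, Matrix.charpolyRev_eq_prod_roots, hprod]
  simp only [hf]
  exact Multiset.prod_one_add_mul_conj_nonneg _

theorem Matrix.det_kronecker_conj_add_nonneg_of_isUnit {K₁ : Matrix n n ℂ} (h : IsUnit K₁.det)
    (K₂ : Matrix n n ℂ) : 0 ≤ (K₁ ⊗ₖ K₁.map conj + K₂ ⊗ₖ K₂.map conj).det := by
  have hK : K₂ = K₁ * (K₁⁻¹ * K₂) := (Matrix.mul_nonsing_inv_cancel_left K₁ K₂ h).symm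
  set M := K₁⁻¹ * K₂
  have h1 : K₁ ⊗ₖ K₁.map conj + K₂ ⊗ₖ K₂.map conj
      = (K₁ ⊗ₖ K₁.map conj) * (1 + M ⊗ₖ M.map conj) := by
    rw [hK, Matrix.map_mul, Matrix.mul_kronecker_mul, mul_add, mul_one]
  have h2 : (K₁.map conj).det = conj K₁.det := ((starRingEnd ℂ).map_det K₁).symm
  rw [h1, det_mul, det_kronecker, h2, ← mul_pow, Complex.mul_conj]
  refine mul_nonneg (pow_nonneg ?_ _) (Matrix.det_one_add_kronecker_conj_nonneg M)
  exact_mod_cast Complex.normSq_nonneg _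

theorem Matrix.det_kronecker_conj_add_nonneg (K₁ K₂ : Matrix n n ℂ) :
    0 ≤ (K₁ ⊗ₖ K₁.map conj + K₂ ⊗ₖ K₂.map conj).det := by
  let F : ℂ → Matrix n n ℂ := fun t => K₁ + t • 1
  have hF : Continuous F := by fun_prop
  have hc : Continuous fun t => (F t ⊗ₖ (F t).map conj + K₂ ⊗ₖ K₂.map conj).det := by
    refine Continuous.matrix_det (Continuous.add ?_ continuous_const)
    refine continuous_matrix fun i j => ?_
    exact (hF.matrix_elem _ _).mul (Complex.continuous_conj.comp (hF.matrix_elem _ _))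
  have hev : ∀ᶠ t in 𝓝[≠] (0 : ℂ), IsUnit (F t).det := by
    have hfin : {t : ℂ | (-K₁).charpoly.IsRoot t}.Finite :=
      Polynomial.finite_setOfPred_isRoot (-K₁).charpoly_monic.ne_zero
    have := (hfin.subset (Set.sdiff_subset (t := {0}))).isClosed.isOpen_compl.mem_nhds
      (x := (0 : ℂ)) (by simp)
    filter_upwards [nhdsWithin_le_nhds this, self_mem_nhdsWithin] with t ht ht0
    rw [isUnit_iff_ne_zero]
    intro h0
    refine ht ⟨?_, ht0⟩
    change (-K₁).charpoly.eval t = 0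
    rw [Matrix.eval_charpoly, ← h0]
    simp [F, add_comm, ← Matrix.smul_one_eq_diagonal]
  have hlim := (hc.tendsto 0).mono_left (nhdsWithin_le_nhds (s := {0}ᶜ))
  have h0 : F 0 = K₁ := by simp [F]
  rw [h0] at hlim
  exact ge_of_tendsto hlim
    (hev.mono fun t ht => Matrix.det_kronecker_conj_add_nonneg_of_isUnit ht K₂)

theorem LinearMap.det_sum_conjugation (K₁ K₂ : Matrix n n ℂ)
    (T : Matrix n n ℂ →ₗ[ℂ] Matrix n n ℂ)
    (hT : ∀ A, T A = K₁ * A * K₁ᴴ + K₂ * A * K₂ᴴ) :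
    LinearMap.det T = (K₁ ⊗ₖ K₁.map conj + K₂ ⊗ₖ K₂.map conj).det := by
  let e : Matrix n n ℂ ≃ₗ[ℂ] (n × n → ℂ) :=
    (LinearEquiv.curry ℂ ℂ n n).symm
  rw [← LinearMap.det_conj T e, ← LinearMap.det_toLin']
  congr 1
  refine LinearMap.ext fun v => ?_
  obtain ⟨A, rfl⟩ := e.surjective v
  have he : e A = vec Aᵀ := rfl
  have h (K : Matrix n n ℂ) : (K ⊗ₖ K.map conj) *ᵥ vec Aᵀ = vec (K * A * Kᴴ)ᵀ := by
    rw [Matrix.kronecker_mulVec_vec, Matrix.transpose_mul, Matrix.transpose_mul, mul_assoc]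
    rfl
  simp only [LinearMap.comp_apply, LinearEquiv.coe_coe, hT,
    Matrix.toLin'_apply, he, Matrix.add_mulVec, h]
  rfl

end

/-- the determinant of a completely positive map of Kraus rank at most two,
`T(A) = K₁ A K₁ᴴ + K₂ A K₂ᴴ`, is real and nonnegative. -/
theorem det_krausRankTwo_nonneg {d : ℕ} (K₁ K₂ : Mat d)
    (T : Mat d →ₗ[ℂ] Mat d)
    (hT : ∀ A : Mat d, T A = K₁ * A * K₁ᴴ + K₂ * A * K₂ᴴ) :
    ∃ r : ℝ, LinearMap.det T = (r : ℂ) ∧ 0 ≤ r := by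
  have h := Matrix.det_kronecker_conj_add_nonneg K₁ K₂
  rw [← LinearMap.det_sum_conjugation K₁ K₂ T hT, Complex.nonneg_iff] at h
  exact ⟨_, Complex.ext rfl (by simpa using h.2.symm), h.1⟩
end
end

section
/- Suppose ⌊d/2⌋ is odd. If T₁ and T₂ are positive trace-preserving linear maps on M_d whose composition T₁ ∘ T₂ equals the matrix transposition map θ(A) = Aᵀ, then at least one of T₁, T₂ is a unitary conjugation, i.e., of the form A ↦ U A U† with U unitary. (In other words, the transposition is indivisible within the set of positive trace-preserving maps.) -/
open Matrix
open scoped Kronecker ComplexOrder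

noncomputable section

/-- A linear map on `M_d` is trace-preserving if it preserves the trace. -/
def IsTracePreserving {d : ℕ} (T : Mat d →ₗ[ℂ] Mat d) : Prop :=
  ∀ A : Mat d, (T A).trace = A.trace

/-- A linear map on `M_d` is positive if it maps positive semidefinite matrices to
positive semidefinite matrices. -/
def IsPositiveMap {d : ℕ} (T : Mat d →ₗ[ℂ] Mat d) : Prop :=
  ∀ A : Mat d, A.PosSemidef → (T A).PosSemidef

/-- A unitary conjugation is a map of the form `A ↦ U * A * Uᴴ` with `U` unitary. -/
def IsUnitaryConj {d : ℕ} (T : Mat d →ₗ[ℂ] Mat d) : Prop :=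
  ∃ U : Mat d, U ∈ Matrix.unitaryGroup (Fin d) ℂ ∧ ∀ A : Mat d, T A = U * A * Uᴴ

/-- The rank-one matrix `z zᴴ`. -/
abbrev rankOne {d : ℕ} (z : Fin d → ℂ) : Mat d := vecMulVec z (star z)

lemma rankOne_mul_self {d : ℕ} (z : Fin d → ℂ) :
    rankOne z * rankOne z = (rankOne z).trace • rankOne z := by
  rw [rankOne, vecMulVec_mul_vecMulVec, trace_vecMulVec, dotProduct_comm, vecMulVec_smul]

lemma rankOne_conjTranspose {d : ℕ} (z : Fin d → ℂ) : (rankOne z)ᴴ = rankOne z := by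
  rw [rankOne, conjTranspose_vecMulVec, star_star]

lemma rankOne_posSemidef {d : ℕ} (z : Fin d → ℂ) : (rankOne z).PosSemidef :=
  posSemidef_vecMulVec_self_star z

lemma rankOne_smul {d : ℕ} {c : ℂ} (hc : 0 ≤ c) (z : Fin d → ℂ) :
    ∃ y, c • rankOne z = rankOne y := by
  obtain ⟨r, hr⟩ : ∃ r : ℝ, c = (r : ℂ) * r := by
    refine ⟨√c.re, ?_⟩
    rw [← Complex.ofReal_mul, Real.mul_self_sqrt (Complex.le_def.mp hc).1]
    exact Complex.eq_re_of_ofReal_le hc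
  refine ⟨(r : ℂ) • z, ?_⟩
  ext i j
  simp [vecMulVec_apply, hr]
  ring

open scoped MatrixOrder Matrix.Norms.L2Operator in
lemma Matrix.PosSemidef.exists_conjTranspose_mul_self {d : ℕ} {A : Mat d} (hA : A.PosSemidef) :
    ∃ R : Mat d, A = Rᴴ * R :=
  CStarAlgebra.nonneg_iff_eq_star_mul_self.mp hA.nonneg

/-- A positive semidefinite matrix dominated by a rank-one matrix is a multiple of it. -/
lemma eq_smul_rankOne_of_add {d : ℕ} {A B : Mat d} {z : Fin d → ℂ} (hz : z ≠ 0)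
    (hA : A.PosSemidef) (hB : B.PosSemidef) (h : A + B = rankOne z) :
    ∃ c : ℂ, 0 ≤ c ∧ A = c • rankOne z := by
  set P := rankOne z with hP
  set n := P.trace with hn
  have hPP : P * P = n • P := rankOne_mul_self z
  have hn0 : n ≠ 0 := by
    rw [hn, Ne, (rankOne_posSemidef z).trace_eq_zero_iff]
    simpa using hz
  have hnn : 0 ≤ n := (rankOne_posSemidef z).trace_nonneg
  have hns : star n = n := (IsSelfAdjoint.of_nonneg hnn)
  set Q : Mat d := n • 1 - P with hQ
  have hQs : Qᴴ = Q := by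
    simp only [hQ, conjTranspose_sub, conjTranspose_smul, conjTranspose_one, hns]
    rw [hP, rankOne_conjTranspose]
  have hPQ : P * Q = 0 := by simp [hQ, mul_sub, hPP]
  have hsum : Qᴴ * A * Q + Qᴴ * B * Q = 0 := by
    rw [← add_mul, ← mul_add, h, mul_assoc, hPQ, mul_zero]
  have h1 := hA.conjTranspose_mul_mul_same Q
  have h2 := hB.conjTranspose_mul_mul_same Q
  have h3 : Qᴴ * A * Q = 0 := by
    rw [← h1.trace_eq_zero_iff]
    have ht := congrArg trace hsum
    rw [trace_add, trace_zero] at ht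
    exact ((add_eq_zero_iff_of_nonneg h1.trace_nonneg h2.trace_nonneg).mp ht).1
  have hAQ : A * Q = 0 := by
    obtain ⟨R, rfl⟩ := hA.exists_conjTranspose_mul_self
    have : (R * Q)ᴴ * (R * Q) = 0 := by
      rw [conjTranspose_mul, ← h3]; simp only [mul_assoc]
    rw [mul_assoc, conjTranspose_mul_self_eq_zero.mp this, mul_zero]
  have hAP : n • A = A * P := by
    simpa [hQ, mul_sub, sub_eq_zero] using hAQ
  have hPA : n • A = P * A := by
    have := congrArg conjTranspose hAP
    rwa [conjTranspose_smul, conjTranspose_mul, hns, hA.1.eq, hP, rankOne_conjTranspose] at this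
  have hPAP : P * A * P = (star z ⬝ᵥ A *ᵥ z) • P := by
    rw [hP, rankOne, vecMulVec_mul, vecMulVec_mul_vecMulVec, dotProduct_mulVec, vecMulVec_smul]
  have hfin : (n * n) • A = (star z ⬝ᵥ A *ᵥ z) • P := by
    rw [← hPAP, ← hPA, smul_mul_assoc, ← hAP, smul_smul]
  refine ⟨(n * n)⁻¹ * (star z ⬝ᵥ A *ᵥ z),
    mul_nonneg (inv_nonneg.mpr (mul_nonneg hnn hnn)) (hA.dotProduct_mulVec_nonneg z), ?_⟩
  rw [mul_smul, ← hfin, smul_smul, inv_mul_cancel₀ (mul_ne_zero hn0 hn0), one_smul]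

lemma exists_sum_rankOne {d : ℕ} {A : Mat d} (hA : A.PosSemidef) :
    ∃ q : Fin d → Fin d → ℂ, A = ∑ i, rankOne (q i) := by
  obtain ⟨R, rfl⟩ := hA.exists_conjTranspose_mul_self
  refine ⟨fun i => star (R i), ?_⟩
  ext k l
  rw [Matrix.sum_apply]
  simp [mul_apply, vecMulVec_apply]

/-- A map sending every matrix `z zᴴ` to a matrix of the same form. -/
def MapsRankOne {d : ℕ} (T : Mat d →ₗ[ℂ] Mat d) : Prop :=
  ∀ z, ∃ y, T (rankOne z) = rankOne y

lemma mapsRankOne_of_inverse {d : ℕ} {T S : Mat d →ₗ[ℂ] Mat d}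
    (hT : IsPositiveMap T) (hS : IsPositiveMap S)
    (hST : ∀ A, S (T A) = A) (hTS : ∀ A, T (S A) = A) : MapsRankOne T := by
  intro z
  by_cases hz : z = 0
  · exact ⟨0, by simp [hz]⟩
  obtain ⟨q, hq⟩ := exists_sum_rankOne (hT _ (rankOne_posSemidef z))
  have hsum : rankOne z = ∑ i, S (rankOne (q i)) := by
    rw [← map_sum, ← hq, hST]
  have key : ∀ i, ∃ c : ℂ, 0 ≤ c ∧ S (rankOne (q i)) = c • rankOne z := fun i => by
    refine eq_smul_rankOne_of_add (B := ∑ j ∈ Finset.univ.erase i, S (rankOne (q j))) hz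
      (hS _ (rankOne_posSemidef _))
      (posSemidef_sum _ fun j _ => hS _ (rankOne_posSemidef _)) ?_
    rw [Finset.add_sum_erase _ (fun j => S (rankOne (q j))) (Finset.mem_univ i), hsum]
  choose c hc hcS using key
  have hex : ∃ i, c i ≠ 0 := by
    by_contra! h0
    refine hz ?_
    simpa [hcS, h0] using hsum
  obtain ⟨i, hi⟩ := hex
  obtain ⟨y, hy⟩ := rankOne_smul (inv_nonneg.mpr (hc i)) (q i)
  refine ⟨y, ?_⟩
  rw [← hy, ← hTS (rankOne (q i)), hcS, map_smul, smul_smul, inv_mul_cancel₀ hi, one_smul]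

lemma trace_smul_one_sub_rankOne_posSemidef {d : ℕ} (z : Fin d → ℂ) :
    ((rankOne z).trace • (1 : Mat d) - rankOne z).PosSemidef := by
  by_cases hz : z = 0
  · simpa [hz] using PosSemidef.zero
  set P := rankOne z with hP
  set n := P.trace with hn
  have hPP : P * P = n • P := rankOne_mul_self z
  have hn0 : n ≠ 0 := by
    rw [hn, Ne, (rankOne_posSemidef z).trace_eq_zero_iff]
    simpa using hz
  have hnn : 0 ≤ n := (rankOne_posSemidef z).trace_nonneg
  have hns : star n = n := (IsSelfAdjoint.of_nonneg hnn)
  have hQs : (n • (1 : Mat d) - P)ᴴ = n • 1 - P := by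
    simp only [conjTranspose_sub, conjTranspose_smul, conjTranspose_one, hns]
    rw [hP, rankOne_conjTranspose]
  have hQ : n • (1 : Mat d) - P = n⁻¹ • ((n • (1 : Mat d) - P)ᴴ * (n • 1 - P)) := by
    rw [hQs, mul_sub, mul_smul_comm, mul_one, sub_mul, hPP, smul_mul_assoc, one_mul, sub_self,
      sub_zero, smul_smul, inv_mul_cancel₀ hn0, one_smul]
  rw [hQ]
  exact (posSemidef_conjTranspose_mul_self _).smul (inv_nonneg.mpr hnn)

lemma map_one_of_inverse {d : ℕ} {T S : Mat d →ₗ[ℂ] Mat d}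
    (hT : IsPositiveMap T) (hTtr : IsTracePreserving T) (hS : IsPositiveMap S)
    (hST : ∀ A, S (T A) = A) (hTS : ∀ A, T (S A) = A) : T 1 = 1 := by
  have hpos : (T 1 - 1).PosSemidef := by
    refine .of_dotProduct_mulVec_nonneg ((hT _ .one).1.sub isHermitian_one) fun v => ?_
    by_cases hv : v = 0
    · simp [hv]
    obtain ⟨w, hw⟩ := mapsRankOne_of_inverse hS hT hTS hST v
    have hTw : T (rankOne w) = rankOne v := by rw [← hw, hTS]
    have htr : (rankOne w).trace = (rankOne v).trace := by rw [← hTw, hTtr]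
    have h := hT _ (trace_smul_one_sub_rankOne_posSemidef w)
    rw [map_sub, map_smul, hTw, htr] at h
    have h' := h.dotProduct_mulVec_nonneg v
    have hn0 : (rankOne v).trace ≠ 0 := by
      rw [Ne, (rankOne_posSemidef v).trace_eq_zero_iff]
      simpa using hv
    have hnn : 0 ≤ (rankOne v).trace := (rankOne_posSemidef v).trace_nonneg
    have hn : star v ⬝ᵥ v = (rankOne v).trace := by rw [trace_vecMulVec, dotProduct_comm]
    have e : star v ⬝ᵥ ((rankOne v).trace • T 1 - rankOne v) *ᵥ v
        = (rankOne v).trace * (star v ⬝ᵥ (T 1 - 1) *ᵥ v) := by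
      rw [sub_mulVec, sub_mulVec, one_mulVec, dotProduct_sub, dotProduct_sub, smul_mulVec,
        dotProduct_smul, vecMulVec_mulVec, mul_sub, hn]
      simp [hn]
    rw [e] at h'
    rw [← inv_mul_cancel_left₀ hn0 (star v ⬝ᵥ (T 1 - 1) *ᵥ v)]
    exact mul_nonneg (inv_nonneg.mpr hnn) h'
  have : (T 1 - 1).trace = 0 := by rw [trace_sub, hTtr, sub_self]
  exact sub_eq_zero.mp (hpos.trace_eq_zero_iff.mp this)

lemma mul_rankOne_mul_conjTranspose {d : ℕ} (M : Mat d) (z : Fin d → ℂ) :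
    M * rankOne z * Mᴴ = rankOne (M *ᵥ z) := by
  rw [rankOne, mul_vecMulVec, vecMulVec_mul, rankOne, star_mulVec]

lemma rankOne_single {d : ℕ} (i : Fin d) : rankOne (Pi.single i 1) = single i i 1 := by
  rw [rankOne, single_eq_single_vecMulVec_single, Pi.star_single, star_one]

lemma rankOne_single_add_smul_single {d : ℕ} (k l : Fin d) (x : ℂ) :
    rankOne (Pi.single k 1 + x • Pi.single l 1) =
      single k k 1 + star x • single k l 1 + x • single l k 1 + (x * star x) • single l l 1 := by
  simp only [rankOne, star_add, star_smul, Pi.star_single, star_one, add_vecMulVec, vecMulVec_add,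
    smul_vecMulVec, vecMulVec_smul, ← single_eq_single_vecMulVec_single, smul_add, smul_smul, mul_comm x (star x)]
  abel

lemma linearMap_apply_eq_of_single {d : ℕ} {f g : Mat d →ₗ[ℂ] ℂ}
    (h : ∀ k l, f (single k l 1) = g (single k l 1)) : f = g := by
  refine Matrix.ext_linearMap _ fun k l => LinearMap.ext_ring ?_
  simpa using h k l

lemma eq_zero_of_forall_nonneg {a b : ℂ} {δ : ℝ} (hδ : δ ≤ 1)
    (h : ∀ x : ℂ, 0 ≤ star x * b + x * a + x * star x * δ) : a = 0 ∧ b = 0 := by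
  have key : ∀ s : ℂ, (∀ t : ℝ, 0 ≤ t * s + t * t * δ) → s = 0 := by
    intro s hs
    have him := (Complex.le_def.mp (hs 1)).2
    have hre := (Complex.le_def.mp (hs (-s.re / 2))).1
    simp at him hre
    refine Complex.ext ?_ him.symm
    rw [Complex.zero_re]
    nlinarith [mul_le_mul_of_nonneg_left hδ (sq_nonneg s.re)]
  have h1 : a + b = 0 := key _ fun t => by
    convert h t using 1
    simp
    ring
  have h2 : Complex.I * (a - b) = 0 := key _ fun t => by
    convert h (t * Complex.I) using 1
    simp
    linear_combination (t * t * δ : ℂ) * Complex.I_mul_I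
  have h3 : a - b = 0 := by simpa using h2
  constructor
  · linear_combination (h1 + h3) / 2
  · linear_combination (h1 - h3) / 2

section NormalForm

variable {d : ℕ} {T : Mat d →ₗ[ℂ] Mat d}

lemma map_single_diag (hp : MapsRankOne T) (hE : ∀ i, T (single i i 1) = single i i 1)
    {k l : Fin d} (hkl : k ≠ l) (i : Fin d) : T (single k l 1) i i = 0 := by
  have aux : ∀ k l : Fin d, i ≠ l → T (single k l 1) i i = 0 ∧ T (single l k 1) i i = 0 := by
    intro k l hil
    refine eq_zero_of_forall_nonneg (δ := if k = i then 1 else 0) (by split_ifs <;> simp) ?_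
    intro x
    obtain ⟨y, hy⟩ := hp (Pi.single l 1 + x • Pi.single k 1)
    have hy' := (rankOne_posSemidef y).diag_nonneg (i := i)
    rw [← hy, rankOne_single_add_smul_single] at hy'
    simp only [map_add, map_smul, hE, Matrix.add_apply, Matrix.smul_apply, smul_eq_mul] at hy'
    convert hy' using 1
    by_cases hk : k = i <;> simp [hk, hil.symm]
  by_cases h : i = l
  · exact (aux l k (h ▸ hkl.symm)).2
  · exact (aux k l h).1

lemma map_apply_diag (hp : MapsRankOne T) (hE : ∀ i, T (single i i 1) = single i i 1)
    (A : Mat d) (i : Fin d) : T A i i = A i i := by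
  have : entryLinearMap ℂ ℂ i i ∘ₗ T = entryLinearMap ℂ ℂ i i := by
    refine linearMap_apply_eq_of_single fun k l => ?_
    by_cases hkl : k = l
    · subst hkl
      simp [hE]
    · have : ¬ (k = i ∧ l = i) := fun h => hkl (h.1.trans h.2.symm)
      simp [map_single_diag hp hE hkl, this]
  exact LinearMap.congr_fun this A

lemma map_single_offDiag (hp : MapsRankOne T) (hE : ∀ i, T (single i i 1) = single i i 1)
    {k l i j : Fin d} (hij : i ≠ j) (h1 : ¬ (k = i ∧ l = j)) (h2 : ¬ (k = j ∧ l = i)) :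
    T (single k l 1) i j = 0 := by
  by_cases hkl : k = l
  · subst hkl
    simp [hE, h1]
  have hout : (i ≠ k ∧ i ≠ l) ∨ (j ≠ k ∧ j ≠ l) := by grind
  have key : ∀ x : ℂ, star x * T (single k l 1) i j + x * T (single l k 1) i j = 0 := by
    intro x
    obtain ⟨y, hy⟩ := hp (Pi.single k 1 + x • Pi.single l 1)
    have hzero : ∀ m, m ≠ k → m ≠ l → y m = 0 := by
      intro m hk hl
      have := map_apply_diag hp hE (rankOne (Pi.single k 1 + x • Pi.single l 1)) m
      rw [hy] at this
      simpa [vecMulVec_apply, Pi.single_apply, hk, hl] using this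
    have hM : rankOne y i j = 0 := by
      rcases hout with h | h
      · simp [vecMulVec_apply, hzero i h.1 h.2]
      · simp [vecMulVec_apply, hzero j h.1 h.2]
    rw [← hy, rankOne_single_add_smul_single] at hM
    have hk : ¬ (k = i ∧ k = j) := fun h => hij (h.1.symm.trans h.2)
    have hl : ¬ (l = i ∧ l = j) := fun h => hij (h.1.symm.trans h.2)
    simp only [map_add, map_smul, hE, Matrix.add_apply, Matrix.smul_apply, smul_eq_mul,
      Matrix.single_apply, hk, hl, if_false, mul_zero, add_zero, zero_add] at hM
    exact hM
  have e1 := key 1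
  have e2 := key Complex.I
  simp at e1 e2
  linear_combination e1 / 2 + Complex.I / 2 * e2 +
    (T (single k l 1) i j - T (single l k 1) i j) / 2 * Complex.I_mul_I

lemma map_apply_offDiag (hp : MapsRankOne T) (hE : ∀ i, T (single i i 1) = single i i 1)
    (A : Mat d) {i j : Fin d} (hij : i ≠ j) :
    T A i j = T (single i j 1) i j * A i j + T (single j i 1) i j * A j i := by
  have : entryLinearMap ℂ ℂ i j ∘ₗ T = T (single i j 1) i j • entryLinearMap ℂ ℂ i j +
      T (single j i 1) i j • entryLinearMap ℂ ℂ j i := by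
    refine linearMap_apply_eq_of_single fun k l => ?_
    by_cases h1 : k = i ∧ l = j
    · obtain ⟨rfl, rfl⟩ := h1
      simp [hij]
    by_cases h2 : k = j ∧ l = i
    · obtain ⟨rfl, rfl⟩ := h2
      simp [hij.symm]
    simp [map_single_offDiag hp hE hij h1 h2, h1, h2]
  exact LinearMap.congr_fun this A

lemma map_rankOne_minor (hp : MapsRankOne T) (z : Fin d → ℂ) (i j k : Fin d) :
    T (rankOne z) i j * T (rankOne z) j k = T (rankOne z) i k * T (rankOne z) j j := by
  obtain ⟨y, hy⟩ := hp z
  simp only [hy, vecMulVec_apply]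
  ring

lemma coeff_relation_pair (hp : MapsRankOne T) (hE : ∀ i, T (single i i 1) = single i i 1)
    {i j : Fin d} (hij : i ≠ j) :
    T (single i j 1) i j * T (single i j 1) j i = 0 ∧
    T (single j i 1) i j * T (single j i 1) j i = 0 ∧
    T (single i j 1) i j * T (single j i 1) j i +
      T (single j i 1) i j * T (single i j 1) j i = 1 := by
  have key : ∀ p : ℂ, (T (single i j 1) i j * p + T (single j i 1) i j * star p) *
      (T (single j i 1) j i * star p + T (single i j 1) j i * p) = p * star p := by
    intro p
    have h := map_rankOne_minor hp (fun m => if m = j then 1 else p) i j i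
    rw [map_apply_offDiag hp hE _ hij, map_apply_offDiag hp hE _ hij.symm,
      map_apply_diag hp hE, map_apply_diag hp hE] at h
    simpa [vecMulVec_apply, hij] using h
  generalize T (single i j 1) i j = b at *
  generalize T (single j i 1) i j = c at *
  generalize T (single j i 1) j i = b' at *
  generalize T (single i j 1) j i = c' at *
  have e1 := key 1
  have e2 := key Complex.I
  have e3 := key (1 + Complex.I)
  simp at e1 e2 e3
  have hI := Complex.I_mul_I
  have f1 : (b - c) * (b' - c') = 1 := by
    linear_combination e2 + (b - c) * (b' - c') * hI
  have f2 : b * c' - c * b' = 0 := by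
    linear_combination (-Complex.I / 2) * (e3 - e1 + Complex.I ^ 2 * f1) + (b * c' - c * b') * hI
  refine ⟨?_, ?_, ?_⟩
  · linear_combination (e1 - f1) / 4 + f2 / 2
  · linear_combination (e1 - f1) / 4 - f2 / 2
  · linear_combination (e1 + f1) / 2

lemma coeff_relation_triple (hp : MapsRankOne T) (hE : ∀ i, T (single i i 1) = single i i 1)
    {i j k : Fin d} (hij : i ≠ j) (hjk : j ≠ k) (hik : i ≠ k) :
    T (single i j 1) i j * T (single k j 1) j k = 0 ∧
    T (single j i 1) i j * T (single j k 1) j k = 0 := by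
  have key : ∀ p q : ℂ, (T (single i j 1) i j * p + T (single j i 1) i j * star p) *
      (T (single j k 1) j k * star q + T (single k j 1) j k * q) =
      T (single i k 1) i k * (p * star q) + T (single k i 1) i k * (q * star p) := by
    intro p q
    have h := map_rankOne_minor hp (fun m => if m = j then 1 else if m = i then p else q) i j k
    rw [map_apply_offDiag hp hE _ hij, map_apply_offDiag hp hE _ hjk,
      map_apply_offDiag hp hE _ hik, map_apply_diag hp hE] at h
    simpa [vecMulVec_apply, hij, hik.symm, hjk.symm] using h
  generalize T (single i j 1) i j = b at *
  generalize T (single j i 1) i j = c at *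
  generalize T (single j k 1) j k = b' at *
  generalize T (single k j 1) j k = c' at *
  generalize T (single i k 1) i k = b'' at *
  generalize T (single k i 1) i k = c'' at *
  have e1 := key 1 1
  have e2 := key Complex.I 1
  have e3 := key 1 Complex.I
  have e4 := key Complex.I Complex.I
  simp at e1 e2 e3 e4
  have hI := Complex.I_mul_I
  have f2 : (b - c) * (b' + c') = b'' - c'' := by
    linear_combination -Complex.I * e2 + ((b - c) * (b' + c') - (b'' - c'')) * hI
  have f3 : (b + c) * (b' - c') = b'' - c'' := by
    linear_combination Complex.I * e3 + ((b + c) * (b' - c') - (b'' - c'')) * hI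
  have f4 : (b - c) * (b' - c') = b'' + c'' := by
    linear_combination e4 + (b - c) * (b' - c') * hI
  constructor
  · linear_combination (e1 - f4 + f2 - f3) / 4
  · linear_combination (e1 - f4 - f2 + f3) / 4

lemma coeff_relation (hp : MapsRankOne T) (hE : ∀ i, T (single i i 1) = single i i 1)
    {i j k : Fin d} (hij : i ≠ j) (hjk : j ≠ k) :
    T (single i j 1) i j * T (single k j 1) j k = 0 := by
  by_cases hik : i = k
  · subst hik
    exact (coeff_relation_pair hp hE hij).1
  · exact (coeff_relation_triple hp hE hij hjk hik).1

lemma coeff_dichotomy (hp : MapsRankOne T) (hE : ∀ i, T (single i i 1) = single i i 1) :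
    (∀ i j, i ≠ j → T (single i j 1) i j = 0) ∨ (∀ i j, i ≠ j → T (single j i 1) i j = 0) := by
  by_contra! h
  obtain ⟨⟨i, j, hij, hb⟩, k, l, hkl, hc⟩ := h
  have h1 : ∀ m, m ≠ j → T (single m j 1) j m = 0 := fun m hm =>
    (mul_eq_zero.mp (coeff_relation hp hE hij hm.symm)).resolve_left hb
  by_cases hkj : k = j
  · subst hkj
    exact hc (h1 l hkl.symm)
  · have h2 := (coeff_relation_pair hp hE (Ne.symm hkj)).2.2
    rw [h1 k hkj, zero_mul, add_zero] at h2
    exact (mul_ne_zero (left_ne_zero_of_mul_eq_one h2) hc) (coeff_relation hp hE (Ne.symm hkj) hkl)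

lemma exists_diagonal_form (hp : MapsRankOne T) (hE : ∀ i, T (single i i 1) = single i i 1) :
    ∃ y : Fin d → ℂ, (∀ i, y i * star (y i) = 1) ∧
      ((∀ A, T A = diagonal y * A * (diagonal y)ᴴ) ∨
        (∀ A, T A = diagonal y * Aᵀ * (diagonal y)ᴴ)) := by
  obtain ⟨y, hy⟩ := hp 1
  have hy1 : ∀ i, y i * star (y i) = 1 := fun i => by
    have := map_apply_diag hp hE (rankOne 1) i
    rw [hy] at this
    simpa [vecMulVec_apply] using this
  have hoff : ∀ i j, i ≠ j → T (single i j 1) i j + T (single j i 1) i j = y i * star (y j) :=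
    fun i j hij => by
      have := map_apply_offDiag hp hE (rankOne 1) hij
      rw [hy] at this
      simpa [vecMulVec_apply] using this.symm
  refine ⟨y, hy1, ?_⟩
  obtain h | h := coeff_dichotomy hp hE
  · refine .inr fun A => ?_
    ext i j
    rw [diagonal_conjTranspose, mul_diagonal, diagonal_mul, Pi.star_apply, transpose_apply]
    obtain rfl | hij := eq_or_ne i j
    · rw [map_apply_diag hp hE]
      linear_combination -A i i * hy1 i
    · rw [map_apply_offDiag hp hE _ hij, h i j hij]
      linear_combination A j i * (hoff i j hij) - A j i * h i j hij
  · refine .inl fun A => ?_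
    ext i j
    rw [diagonal_conjTranspose, mul_diagonal, diagonal_mul, Pi.star_apply]
    obtain rfl | hij := eq_or_ne i j
    · rw [map_apply_diag hp hE]
      linear_combination -A i i * hy1 i
    · rw [map_apply_offDiag hp hE _ hij, h i j hij]
      linear_combination A i j * (hoff i j hij) - A i j * h i j hij

end NormalForm

/-- Wigner's theorem for positive trace-preserving maps with positive inverse. -/
theorem exists_unitary_of_inverse {d : ℕ} {T S : Mat d →ₗ[ℂ] Mat d}
    (hT : IsPositiveMap T) (hTtr : IsTracePreserving T) (hS : IsPositiveMap S)
    (hST : ∀ A, S (T A) = A) (hTS : ∀ A, T (S A) = A) :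
    ∃ U ∈ Matrix.unitaryGroup (Fin d) ℂ,
      (∀ A, T A = U * A * Uᴴ) ∨ (∀ A, T A = U * Aᵀ * Uᴴ) := by
  have hp := mapsRankOne_of_inverse hT hS hST hTS
  choose f hf using fun i : Fin d => hp (Pi.single i 1)
  simp only [rankOne_single] at hf
  set V : Mat d := (of f)ᵀ with hV
  have hVf : ∀ i, V * single i i 1 * Vᴴ = rankOne (f i) := fun i => by
    rw [← rankOne_single, mul_rankOne_mul_conjTranspose]
    simp [hV]
  have hsum : (1 : Mat d) = ∑ i, single i i 1 := by
    rw [← diagonal_one, ← sum_single_eq_diagonal]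
  have hVV : V * Vᴴ = 1 := by
    conv_rhs => rw [← map_one_of_inverse hT hTtr hS hST hTS, hsum, map_sum]
    simp only [hf, ← hVf, ← Finset.sum_mul, ← Finset.mul_sum, ← hsum, mul_one]
  have hVV' : Vᴴ * V = 1 := mul_eq_one_comm.mp hVV
  let T' : Mat d →ₗ[ℂ] Mat d := LinearMap.mulLeft ℂ Vᴴ ∘ₗ LinearMap.mulRight ℂ V ∘ₗ T
  have hT' : ∀ A, T' A = Vᴴ * T A * V := fun A => by simp [T', mul_assoc]
  have hTT' : ∀ A, T A = V * T' A * Vᴴ := fun A => by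
    rw [hT', ← mul_assoc, ← mul_assoc, hVV, one_mul, mul_assoc, hVV, mul_one]
  have hp' : MapsRankOne T' := fun z => by
    obtain ⟨y, hy⟩ := hp z
    refine ⟨Vᴴ *ᵥ y, ?_⟩
    rw [hT', hy, ← mul_rankOne_mul_conjTranspose, conjTranspose_conjTranspose]
  have hE' : ∀ i, T' (single i i 1) = single i i 1 := fun i => by
    rw [hT', hf, ← hVf, ← mul_assoc, ← mul_assoc, hVV', one_mul, mul_assoc, hVV', mul_one]
  obtain ⟨y, hy, h⟩ := exists_diagonal_form hp' hE'
  refine ⟨V * diagonal y, mul_mem ?_ ?_, ?_⟩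
  · rwa [mem_unitaryGroup_iff, star_eq_conjTranspose]
  · rw [mem_unitaryGroup_iff, star_eq_conjTranspose, diagonal_conjTranspose, diagonal_mul_diagonal,
      ← diagonal_one]
    exact congrArg diagonal (funext hy)
  · refine h.imp (fun h A => ?_) (fun h A => ?_) <;>
      rw [hTT', h, conjTranspose_mul] <;> simp only [mul_assoc]

/-- if `⌊d/2⌋` is odd, the transposition map is indivisible within the
set of positive trace-preserving maps: whenever `T₁ ∘ T₂` is the transposition with
`T₁, T₂` positive and trace-preserving, one of them is a unitary conjugation. -/
theorem transpose_indivisible {d : ℕ} (hd : Odd (d / 2))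
    (T₁ T₂ : Mat d →ₗ[ℂ] Mat d)
    (h₁pos : IsPositiveMap T₁) (h₁tp : IsTracePreserving T₁)
    (h₂pos : IsPositiveMap T₂) (h₂tp : IsTracePreserving T₂)
    (hcomp : ∀ A : Mat d, (T₁ ∘ₗ T₂) A = Aᵀ) :
    IsUnitaryConj T₁ ∨ IsUnitaryConj T₂ := by
  let S : Mat d →ₗ[ℂ] Mat d := (transposeLinearEquiv (Fin d) (Fin d) ℂ ℂ).toLinearMap ∘ₗ T₁
  have hS : ∀ A, S A = (T₁ A)ᵀ := fun A => rfl
  have hcomp' : ∀ A, T₁ (T₂ A) = Aᵀ := hcomp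
  have hST : ∀ A, S (T₂ A) = A := fun A => by rw [hS, hcomp', transpose_transpose]
  have hTS : ∀ A, T₂ (S A) = A := by
    have h : T₂ * S = 1 := mul_eq_one_comm.mp (LinearMap.ext hST : S * T₂ = 1)
    exact fun A => LinearMap.congr_fun h A
  have hSpos : IsPositiveMap S := fun A hA => (h₁pos A hA).transpose
  obtain ⟨U, hU, h | h⟩ := exists_unitary_of_inverse h₂pos h₂tp hSpos hST hTS
  · exact .inr ⟨U, hU, h⟩
  · refine .inl ⟨Uᴴ, Unitary.star_mem hU, fun A => ?_⟩
    have hUU : U * Uᴴ = 1 := mem_unitaryGroup_iff.mp hU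
    have hA : T₂ (Uᴴ * A * U)ᵀ = A := by
      rw [h, transpose_transpose, ← mul_assoc, ← mul_assoc, hUU, one_mul, mul_assoc, hUU, mul_one]
    rw [conjTranspose_conjTranspose, ← transpose_transpose (Uᴴ * A * U), ← hcomp', hA]
end
end
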